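/- arXiv:1405.1018 — 4 statements merged into one kernel-verified Lean document; each statement's English description precedes it below -/
import Mathlib

section
/- Let H ≥ 1 be an integer and let f: ℕ → ℝ be multiplicative with |f(p^k)| ≤ H^k for all prime powers p^k. For 1 ≤ i ≤ H−1 define multiplicative functions f_i: ℕ → ℝ by f_i(p) = f(p)/H and f_i(p^k) = 0 for all primes p and all k ≥ 2, and let f_H be the unique multiplicative function satisfying f = f₁ * f₂ * ⋯ * f_H (Dirichlet convolution). Then |f_H(p^k)| ≤ (3H)^k for every prime p and every integer k ≥ 1. -/
/-- `f` is multiplicative: `f(1) = 1` and `f(mn) = f(m)f(n)` for coprime `m, n`. -/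
def IsMult (f : ℕ → ℝ) : Prop :=
  f 1 = 1 ∧ ∀ m n : ℕ, Nat.Coprime m n → f (m * n) = f m * f n

/-- The `H`-fold Dirichlet convolution `(f₁ * ⋯ * f_H)(n) = Σ_{d₁⋯d_H = n} ∏_j f_j(d_j)`. -/
noncomputable def multiConv {H : ℕ} (fi : Fin H → ℕ → ℝ) (n : ℕ) : ℝ :=
  ∑ d ∈ Fintype.piFinset fun _ : Fin H => n.divisors,
    if ∏ j, d j = n then ∏ j, fi j (d j) else 0

open PowerSeries in
/-- On powers of a prime, Dirichlet convolution is multiplication of Bell series. -/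
theorem multiConv_prime_pow {H : ℕ} (fi : Fin H → ℕ → ℝ) {p : ℕ} (hp : p.Prime) (k : ℕ) :
    multiConv fi (p ^ k) = coeff k (∏ j, mk fun n => fi j (p ^ n)) := by
  rw [coeff_prod, multiConv, ← Finset.sum_filter]
  symm
  refine Finset.sum_bij (fun l _ j => p ^ l j) ?_ ?_ ?_ ?_
  · intro l hl
    rw [Finset.mem_finsuppAntidiag] at hl
    rw [Finset.mem_filter, Fintype.mem_piFinset]
    refine ⟨fun j => ?_, ?_⟩
    · rw [Nat.mem_divisors]
      refine ⟨pow_dvd_pow p ?_, pow_ne_zero _ hp.ne_zero⟩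
      rw [← hl.1]
      exact Finset.single_le_sum (f := fun j => l j) (fun _ _ => Nat.zero_le _)
        (Finset.mem_univ j)
    · rw [Finset.prod_pow_eq_pow_sum, hl.1]
  · intro l _ l' _ h
    ext j
    exact Nat.pow_right_injective hp.two_le (congrFun h j)
  · intro d hd
    rw [Finset.mem_filter, Fintype.mem_piFinset] at hd
    have hpow : ∀ j, ∃ n, d j = p ^ n := fun j => by
      obtain ⟨n, -, hn⟩ := (Nat.dvd_prime_pow hp).1 (Nat.dvd_of_mem_divisors (hd.1 j))
      exact ⟨n, hn⟩
    choose l hl using hpow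
    refine ⟨Finsupp.equivFunOnFinite.symm l, ?_, ?_⟩
    · rw [Finset.mem_finsuppAntidiag]
      refine ⟨?_, Finset.subset_univ _⟩
      apply Nat.pow_right_injective hp.two_le
      simp only [Finsupp.equivFunOnFinite_symm_apply_apply]
      rw [← hd.2, ← Finset.prod_pow_eq_pow_sum]
      exact Finset.prod_congr rfl fun j _ => (hl j).symm
    · funext j
      simp [hl]
  · intro l _
    simp

theorem sum_antidiagonal_pow_mul_pow_le {x y : ℝ} (hx : 0 ≤ x) (hy : 0 ≤ y) (n : ℕ) :
    ∑ ij ∈ Finset.HasAntidiagonal.antidiagonal n, x ^ ij.1 * y ^ ij.2 ≤ (x + y) ^ n := by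
  rw [(Commute.all x y).add_pow']
  refine Finset.sum_le_sum fun ij hij => ?_
  have h : 1 ≤ n.choose ij.1 :=
    Nat.choose_pos (by rw [Finset.HasAntidiagonal.mem_antidiagonal] at hij; omega)
  exact le_self_nsmul (by positivity) (by omega)

open PowerSeries in
/-- Geometric bounds on the coefficients of two power series multiply. -/
theorem abs_coeff_mul_le {F G : PowerSeries ℝ} {x y : ℝ} (hx : 0 ≤ x) (hy : 0 ≤ y)
    (hF : ∀ n, |coeff n F| ≤ x ^ n) (hG : ∀ n, |coeff n G| ≤ y ^ n) (n : ℕ) :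
    |coeff n (F * G)| ≤ (x + y) ^ n := by
  rw [coeff_mul]
  refine (Finset.abs_sum_le_sum_abs _ _).trans
    (le_trans (Finset.sum_le_sum fun ij _ => ?_) (sum_antidiagonal_pow_mul_pow_le hx hy n))
  rw [abs_mul]
  exact mul_le_mul (hF _) (hG _) (abs_nonneg _) (pow_nonneg hx _)

open PowerSeries in
theorem abs_coeff_pow_le {F : PowerSeries ℝ} (hF : ∀ n, |coeff n F| ≤ 1)
    (m n : ℕ) : |coeff n (F ^ m)| ≤ (m : ℝ) ^ n := by
  induction m generalizing n with
  | zero =>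
    rcases n with _ | n <;> simp [coeff_one]
  | succ m ih =>
    rw [pow_succ]
    push_cast
    exact abs_coeff_mul_le (Nat.cast_nonneg m) zero_le_one ih (by simpa using hF) n

open PowerSeries in
theorem one_add_C_mul_X_mul_mk_neg_pow (a : ℝ) :
    (1 + C a * X) * (mk fun n => (-a) ^ n) = 1 := by
  ext n
  rcases n with _ | n
  · simp
  · simp [add_mul, mul_assoc, coeff_succ_X_mul, coeff_one, pow_succ]
    ring

open PowerSeries in
/-- Let `f` be multiplicative with `|f(p^k)| ≤ H^k`.  If `f₁, …, f_{H-1}` are the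
multiplicative functions with `f_i(p) = f(p)/H` and `f_i(p^k) = 0` for `k ≥ 2`, and
`f_H` is a multiplicative function with `f = f₁ * ⋯ * f_H`, then
`|f_H(p^k)| ≤ (3H)^k` for every prime `p` and `k ≥ 1`. -/
theorem statement_1 (H : ℕ) (hH : 1 ≤ H) (f : ℕ → ℝ) (hf : IsMult f)
    (hfb : ∀ p k : ℕ, p.Prime → 1 ≤ k → |f (p ^ k)| ≤ (H : ℝ) ^ k)
    (fi : Fin H → ℕ → ℝ) (hmult : ∀ j, IsMult (fi j))
    (hsmall : ∀ j : Fin H, (j : ℕ) + 1 < H →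
      (∀ p : ℕ, p.Prime → fi j p = f p / H) ∧
        (∀ p k : ℕ, p.Prime → 2 ≤ k → fi j (p ^ k) = 0))
    (hconv : ∀ n : ℕ, 0 < n → f n = multiConv fi n) :
    ∀ p k : ℕ, p.Prime → 1 ≤ k →
      |fi ⟨H - 1, by omega⟩ (p ^ k)| ≤ ((3 * H : ℕ) : ℝ) ^ k := by
  intro p k hp _
  obtain ⟨m, rfl⟩ : ∃ m, H = m + 1 := ⟨H - 1, by omega⟩
  set a : ℝ := f p / ((m + 1 : ℕ) : ℝ) with ha
  have hm : (0 : ℝ) < ((m + 1 : ℕ) : ℝ) := by positivity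
  have ha1 : |a| ≤ 1 := by
    rw [ha, abs_div, abs_of_pos hm, div_le_one hm]
    simpa using hfb p 1 hp le_rfl
  set F : PowerSeries ℝ := mk fun n => f (p ^ n) with hF
  set G : PowerSeries ℝ := mk fun n => fi (Fin.last m) (p ^ n) with hG
  set D : PowerSeries ℝ := mk fun n => (-a) ^ n with hD
  have hfactor : F = (1 + C a * X) ^ m * G := by
    have hsucc : ∀ j : Fin m, (mk fun n => fi j.castSucc (p ^ n)) = 1 + C a * X := by
      intro j
      obtain ⟨h1, h2⟩ := hsmall j.castSucc (by simp)
      ext n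
      rcases n with _ | _ | n
      · simp [(hmult j.castSucc).1]
      · simp [h1 p hp, coeff_one, ha]
      · simp [h2 p (n + 2) hp (by omega), coeff_one]
    ext n
    rw [hF, coeff_mk, hconv _ (pow_pos hp.pos n), multiConv_prime_pow fi hp,
      Fin.prod_univ_castSucc, Finset.prod_congr rfl fun j _ => hsucc j, Finset.prod_const,
      Finset.card_univ, Fintype.card_fin]
  have hGF : G = F * D ^ m := by
    rw [hfactor, mul_right_comm, ← mul_pow, one_add_C_mul_X_mul_mk_neg_pow, one_pow, one_mul]
  have hFb : ∀ n, |coeff n F| ≤ ((m + 1 : ℕ) : ℝ) ^ n := by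
    intro n
    rw [hF, coeff_mk]
    rcases n with _ | n
    · simp [hf.1]
    · exact hfb p (n + 1) hp (by omega)
  have hDb : ∀ n, |coeff n (D ^ m)| ≤ (m : ℝ) ^ n := by
    refine abs_coeff_pow_le (fun n => ?_) m
    rw [hD, coeff_mk, abs_pow, abs_neg]
    exact pow_le_one₀ (abs_nonneg a) ha1
  have hGk : coeff k G = fi ⟨m + 1 - 1, by omega⟩ (p ^ k) := by
    rw [hG, coeff_mk]
    rfl
  rw [← hGk, hGF]
  refine (abs_coeff_mul_le hm.le (Nat.cast_nonneg m) hFb hDb k).trans ?_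
  refine pow_le_pow_left₀ (by positivity) ?_ k
  push_cast
  linarith [(Nat.cast_nonneg m : (0 : ℝ) ≤ m)]
end

section
/- Let t ≥ 1 be an integer and let d_t: ℕ → ℕ denote the t-fold Dirichlet convolution of the constant function 1 with itself (so d_t(n) is the number of ordered factorizations n = m₁·m₂⋯m_t into t positive integers). Then there exist constants c, C > 0 depending only on t such that for all real x ≥ 2: c·x·(log x)^{t−1} ≤ Σ_{n ≤ x} d_t(n) ≤ C·x·(log x)^{t−1}. -/
/-- `dt t n` is the number of ordered factorizations `n = m₁·m₂⋯m_t` into `t` positive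
integers, i.e. the `t`-fold Dirichlet convolution of the constant function `1` with
itself evaluated at `n`. -/
def dt (t n : ℕ) : ℕ :=
  ((Fintype.piFinset fun _ : Fin t => n.divisors).filter fun d => ∏ j, d j = n).card

open Finset in
/-- An ordered factorization into `t + 1` factors is a first factor together with an ordered
factorization of the cofactor into `t` factors. -/
theorem Nat.card_finMulAntidiag_succ (t n : ℕ) :
    #(Nat.finMulAntidiag (t + 1) n) =
      ∑ p ∈ n.divisorsAntidiagonal, #(Nat.finMulAntidiag t p.2) := by
  rw [← Finset.card_sigma]
  refine Finset.card_nbij' (fun f => ⟨(f 0, ∏ i, Fin.tail f i), Fin.tail f⟩)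
    (fun s => Fin.cons s.1.1 s.2) ?_ ?_ ?_ ?_
  · intro f hf
    simp only [coe_sigma, Set.mem_sigma_iff, mem_coe, Nat.mem_finMulAntidiag,
      Nat.mem_divisorsAntidiagonal, Fin.prod_univ_succ, Fin.tail] at hf ⊢
    refine ⟨hf, trivial, fun h => ?_⟩
    exact hf.2 (by rw [← hf.1, h, mul_zero])
  · rintro ⟨⟨a, b⟩, g⟩ hs
    simp only [coe_sigma, Set.mem_sigma_iff, mem_coe, Nat.mem_finMulAntidiag,
      Nat.mem_divisorsAntidiagonal, Fin.prod_univ_succ, Fin.cons_zero, Fin.cons_succ] at hs ⊢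
    exact ⟨by rw [hs.2.1, hs.1.1], hs.1.2⟩
  · intro f _
    exact Fin.cons_self_tail f
  · rintro ⟨⟨a, b⟩, g⟩ hs
    simp only [coe_sigma, Set.mem_sigma_iff, mem_coe, Nat.mem_finMulAntidiag] at hs
    obtain ⟨-, rfl, -⟩ := hs
    rfl

open Finset ArithmeticFunction in
theorem ArithmeticFunction.zeta_pow_apply (t n : ℕ) :
    ((zeta : ArithmeticFunction ℕ) ^ t) n = #(Nat.finMulAntidiag t n) := by
  induction t generalizing n with
  | zero =>
    obtain rfl | hn := eq_or_ne n 1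
    · simp [Nat.finMulAntidiag_one]
    · simp [Nat.finMulAntidiag_zero_left hn, one_apply_ne hn]
  | succ t ih =>
    rw [pow_succ', mul_apply, Nat.card_finMulAntidiag_succ]
    refine sum_congr rfl fun p hp => ?_
    rw [ih, zeta_apply_ne (Nat.ne_zero_of_mem_divisorsAntidiagonal hp).1, one_mul]

open ArithmeticFunction in
theorem dt_eq_zeta_pow (t : ℕ) {n : ℕ} (hn : n ≠ 0) :
    dt t n = ((zeta : ArithmeticFunction ℕ) ^ t) n := by
  rw [zeta_pow_apply, Nat.finMulAntidiag_eq_piFinset_divisors_filter dvd_rfl hn, dt]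

open Finset in
theorem sum_dt_one (N : ℕ) : ∑ n ∈ Icc 1 N, dt 1 n = N := by
  rw [sum_congr rfl fun n hn => dt_eq_zeta_pow 1 (by grind : n ≠ 0)]
  rw [pow_one]
  exact ArithmeticFunction.sum_Ioc_zeta N

open Finset ArithmeticFunction in
theorem sum_dt_succ (t N : ℕ) :
    ∑ n ∈ Icc 1 N, dt (t + 1) n = ∑ m ∈ Icc 1 N, ∑ n ∈ Icc 1 (N / m), dt t n := by
  have h (t N : ℕ) : ∑ n ∈ Icc 1 N, dt t n =
      ∑ n ∈ Ioc 0 N, ((zeta : ArithmeticFunction ℕ) ^ t) n :=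
    sum_congr rfl fun n hn => dt_eq_zeta_pow t (by grind)
  simp_rw [h]
  rw [pow_succ', sum_Ioc_mul_eq_sum_sum]
  refine sum_congr rfl fun m hm => ?_
  rw [zeta_apply_ne (by grind), one_mul]

open Finset in
theorem sum_dt_floor_succ (t : ℕ) (x : ℝ) :
    ∑ n ∈ Icc 1 ⌊x⌋₊, (dt (t + 1) n : ℝ) =
      ∑ m ∈ Icc 1 ⌊x⌋₊, ∑ n ∈ Icc 1 ⌊x / m⌋₊, (dt t n : ℝ) := by
  simp_rw [Nat.floor_div_natCast]
  exact_mod_cast sum_dt_succ t ⌊x⌋₊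

open Finset in
theorem sum_dt_le (t : ℕ) {x : ℝ} (hx : 1 ≤ x) :
    ∑ n ∈ Icc 1 ⌊x⌋₊, (dt (t + 1) n : ℝ) ≤ x * (1 + Real.log x) ^ t := by
  induction t generalizing x with
  | zero =>
    rw [← Nat.cast_sum, sum_dt_one, pow_zero, mul_one]
    exact Nat.floor_le (by linarith)
  | succ t ih =>
    have hlog : 0 ≤ Real.log x := Real.log_nonneg hx
    have hH := harmonic_floor_le_one_add_log x hx
    rw [harmonic_eq_sum_Icc] at hH
    push_cast at hH
    rw [sum_dt_floor_succ]
    calc ∑ m ∈ Icc 1 ⌊x⌋₊, ∑ n ∈ Icc 1 ⌊x / m⌋₊, (dt (t + 1) n : ℝ)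
        ≤ ∑ m ∈ Icc 1 ⌊x⌋₊, x * (1 + Real.log x) ^ t * (m : ℝ)⁻¹ := by
          refine sum_le_sum fun m hm => ?_
          obtain ⟨hm1, hmx⟩ := mem_Icc.mp hm
          have hm1' : (1 : ℝ) ≤ m := by exact_mod_cast hm1
          have hmx' : (m : ℝ) ≤ x := (Nat.le_floor_iff (by linarith)).mp hmx
          have hxm : 1 ≤ x / m := (one_le_div (by linarith)).mpr hmx'
          have hlog_le : Real.log (x / m) ≤ Real.log x :=
            Real.log_le_log (by linarith) (div_le_self (by linarith) hm1')
          have hlog_nonneg := Real.log_nonneg hxm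
          calc _ ≤ x / m * (1 + Real.log (x / m)) ^ t := ih hxm
            _ ≤ x / m * (1 + Real.log x) ^ t := by gcongr
            _ = _ := by ring
      _ = x * (1 + Real.log x) ^ t * ∑ m ∈ Icc 1 ⌊x⌋₊, (m : ℝ)⁻¹ := by rw [mul_sum]
      _ ≤ x * (1 + Real.log x) ^ t * (1 + Real.log x) := by gcongr
      _ = x * (1 + Real.log x) ^ (t + 1) := by ring

open Finset in
theorem exists_le_sum_dt (t : ℕ) :
    ∃ c : ℝ, 0 < c ∧ ∀ x : ℝ, 1 ≤ x →
      c * x * Real.log x ^ t ≤ ∑ n ∈ Icc 1 ⌊x⌋₊, (dt (t + 1) n : ℝ) := by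
  induction t with
  | zero =>
    refine ⟨1 / 2, by norm_num, fun x hx => ?_⟩
    rw [← Nat.cast_sum, sum_dt_one, pow_zero, mul_one]
    have h1 : (1 : ℝ) ≤ ⌊x⌋₊ := by exact_mod_cast Nat.le_floor (by simpa using hx)
    linarith [Nat.lt_floor_add_one x]
  | succ t ih =>
    obtain ⟨c, hc, ih⟩ := ih
    refine ⟨c / 2 ^ (t + 1), by positivity, fun x hx => ?_⟩
    have hx0 : 0 < x := by linarith
    have hlog : 0 ≤ Real.log x := Real.log_nonneg hx
    have hsqrt : 1 ≤ √x := Real.one_le_sqrt.mpr hx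
    have hsqrt_le : √x ≤ x := Real.sqrt_le_self_iff.mpr (Or.inr hx)
    have hH := log_le_harmonic_floor √x (Real.sqrt_nonneg x)
    rw [harmonic_eq_sum_Icc, Real.log_sqrt hx0.le] at hH
    push_cast at hH
    rw [sum_dt_floor_succ]
    calc c / 2 ^ (t + 1) * x * Real.log x ^ (t + 1)
        = c * x * (Real.log x / 2) ^ t * (Real.log x / 2) := by
          rw [div_pow, pow_succ, pow_succ]; field_simp
      _ ≤ c * x * (Real.log x / 2) ^ t * ∑ m ∈ Icc 1 ⌊√x⌋₊, (m : ℝ)⁻¹ := by gcongr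
      _ = ∑ m ∈ Icc 1 ⌊√x⌋₊, c * x * (Real.log x / 2) ^ t * (m : ℝ)⁻¹ := by rw [mul_sum]
      _ ≤ ∑ m ∈ Icc 1 ⌊√x⌋₊, ∑ n ∈ Icc 1 ⌊x / m⌋₊, (dt (t + 1) n : ℝ) := by
          refine sum_le_sum fun m hm => ?_
          obtain ⟨hm1, hmx⟩ := mem_Icc.mp hm
          have hm0 : (0 : ℝ) < m := by exact_mod_cast hm1
          have hmx' : (m : ℝ) ≤ √x := (Nat.le_floor_iff (by linarith)).mp hmx
          have hle : √x ≤ x / m := by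
            rw [← Real.div_sqrt (x := x)]
            gcongr
          have hlog_le : Real.log x / 2 ≤ Real.log (x / m) := by
            rw [← Real.log_sqrt hx0.le]
            exact Real.log_le_log (by linarith) hle
          calc _ = c * (x / m) * (Real.log x / 2) ^ t := by ring
            _ ≤ c * (x / m) * Real.log (x / m) ^ t := by gcongr
            _ ≤ _ := ih _ (hsqrt.trans hle)
      _ ≤ ∑ m ∈ Icc 1 ⌊x⌋₊, ∑ n ∈ Icc 1 ⌊x / m⌋₊, (dt (t + 1) n : ℝ) :=
          sum_le_sum_of_subset_of_nonneg
            (Icc_subset_Icc_right (Nat.floor_le_floor hsqrt_le))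
            fun _ _ _ => by positivity

/-- For `t ≥ 1` there are constants `c, C > 0` depending only on `t` such that for all
real `x ≥ 2`: `c·x·(log x)^{t−1} ≤ Σ_{n ≤ x} d_t(n) ≤ C·x·(log x)^{t−1}`. -/
theorem statement_3 (t : ℕ) (ht : 1 ≤ t) :
    ∃ c C : ℝ, 0 < c ∧ 0 < C ∧ ∀ x : ℝ, 2 ≤ x →
      c * x * Real.log x ^ (t - 1) ≤ (∑ n ∈ Finset.Icc 1 ⌊x⌋₊, (dt t n : ℝ)) ∧
        (∑ n ∈ Finset.Icc 1 ⌊x⌋₊, (dt t n : ℝ)) ≤ C * x * Real.log x ^ (t - 1) := by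
  obtain ⟨s, rfl⟩ := Nat.exists_eq_add_of_le' ht
  simp only [Nat.add_sub_cancel]
  obtain ⟨c, hc, hlower⟩ := exists_le_sum_dt s
  have hlog2 : 0 < Real.log 2 := Real.log_pos one_lt_two
  refine ⟨c, (1 / Real.log 2 + 1) ^ s, hc, by positivity,
    fun x hx => ⟨hlower x (by linarith), (sum_dt_le s (by linarith)).trans ?_⟩⟩
  have hlog : Real.log 2 ≤ Real.log x := Real.log_le_log two_pos hx
  have hone : 1 ≤ 1 / Real.log 2 * Real.log x := by
    rwa [one_div_mul_eq_div, one_le_div hlog2]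
  calc x * (1 + Real.log x) ^ s ≤ x * ((1 / Real.log 2 + 1) * Real.log x) ^ s := by
        gcongr
        · linarith
        · rw [add_mul, one_mul]
          gcongr
    _ = (1 / Real.log 2 + 1) ^ s * x * Real.log x ^ s := by rw [mul_pow]; ring
end

section
/- Let t ≥ 1 be an integer and let d_t: ℕ → ℕ denote the t-fold Dirichlet convolution of the constant function 1 with itself. Then there exist constants c, C > 0 depending only on t such that for all real x ≥ 2: c·x·(log x)^{t²−1} ≤ Σ_{n ≤ x} d_t(n)² ≤ C·x·(log x)^{t²−1}. -/
namespace PiltzDivisor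

open ArithmeticFunction Finset

lemma zeta_pow_succ_apply (k n : ℕ) : (zeta ^ (k + 1)) n = ∑ d ∈ n.divisors, (zeta ^ k) d := by
  rw [pow_succ', zeta_mul_apply]

lemma card_finMulAntidiag_succ (k n : ℕ) :
    #(Nat.finMulAntidiag (k + 1) n) = ∑ d ∈ n.divisors, #(Nat.finMulAntidiag k d) := by
  rw [← card_sigma]
  refine card_bij' (fun f _ ↦ ⟨∏ i, Fin.tail f i, Fin.tail f⟩)
    (fun p _ ↦ Fin.cons (n / p.1) p.2) ?_ ?_ ?_ ?_
  · intro f hf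
    obtain ⟨rfl, hf0⟩ := Nat.mem_finMulAntidiag.1 hf
    rw [Fin.prod_univ_succ] at hf0 ⊢
    simp only [mem_sigma, Nat.mem_divisors, Nat.mem_finMulAntidiag, Fin.tail]
    exact ⟨⟨dvd_mul_left _ _, hf0⟩, trivial, right_ne_zero_of_mul hf0⟩
  · rintro ⟨d, f⟩ hp
    obtain ⟨hd, hf⟩ := mem_sigma.1 hp
    obtain ⟨hd, hn⟩ := Nat.mem_divisors.1 hd
    rw [Nat.mem_finMulAntidiag] at hf ⊢
    simp only at hf hd
    refine ⟨?_, hn⟩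
    rw [Fin.prod_univ_succ]
    simp [hf.1, Nat.div_mul_cancel hd]
  · intro f hf
    obtain ⟨rfl, hf0⟩ := Nat.mem_finMulAntidiag.1 hf
    rw [Fin.prod_univ_succ] at hf0 ⊢
    simp only [Fin.tail]
    rw [Nat.mul_div_cancel _ (Nat.pos_of_ne_zero (right_ne_zero_of_mul hf0))]
    exact Fin.cons_self_tail f
  · rintro ⟨d, f⟩ hp
    obtain ⟨hf, -⟩ := Nat.mem_finMulAntidiag.1 (mem_sigma.1 hp).2
    simp only at hf
    simp [hf]

lemma card_finMulAntidiag (k n : ℕ) : #(Nat.finMulAntidiag k n) = (zeta ^ k) n := by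
  induction k generalizing n with
  | zero =>
    rw [pow_zero, one_apply]
    split_ifs with h
    · simp [h, Nat.finMulAntidiag_one]
    · simp [Nat.finMulAntidiag_zero_left h]
  | succ k ih => simp_rw [card_finMulAntidiag_succ, zeta_pow_succ_apply, ih]

lemma dt_eq_zeta_pow (k : ℕ) {n : ℕ} (hn : n ≠ 0) : dt k n = (zeta ^ k) n := by
  rw [← card_finMulAntidiag, Nat.finMulAntidiag_eq_piFinset_divisors_filter dvd_rfl hn, dt]

lemma zeta_pow_apply_mul_le (k m n : ℕ) :
    (zeta ^ k) (m * n) ≤ (zeta ^ k) m * (zeta ^ k) n := by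
  induction k generalizing m n with
  | zero =>
    simp only [pow_zero, one_apply, mul_eq_one]
    split_ifs <;> simp_all
  | succ k ih =>
    have hmaps : ∀ p ∈ m.divisors ×ˢ n.divisors, p.1 * p.2 ∈ (m * n).divisors := by
      intro p hp
      simp only [mem_product, Nat.mem_divisors] at hp ⊢
      exact ⟨mul_dvd_mul hp.1.1 hp.2.1, mul_ne_zero hp.1.2 hp.2.2⟩
    simp_rw [zeta_pow_succ_apply]
    calc ∑ d ∈ (m * n).divisors, (zeta ^ k) d
        ≤ ∑ d ∈ (m * n).divisors, ∑ p ∈ m.divisors ×ˢ n.divisors with p.1 * p.2 = d,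
            (zeta ^ k) (p.1 * p.2) := by
          refine sum_le_sum fun d hd ↦ ?_
          obtain ⟨hd, hmn⟩ := Nat.mem_divisors.1 hd
          obtain ⟨a, b, ha, hb, rfl⟩ := (Nat.dvd_mul).1 hd
          refine single_le_sum (f := fun p : ℕ × ℕ ↦ (zeta ^ k) (p.1 * p.2))
            (fun _ _ ↦ Nat.zero_le _) (a := (a, b)) ?_
          simp [ha, hb, left_ne_zero_of_mul hmn, right_ne_zero_of_mul hmn]
      _ = ∑ p ∈ m.divisors ×ˢ n.divisors, (zeta ^ k) (p.1 * p.2) :=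
          sum_fiberwise_of_maps_to hmaps _
      _ ≤ ∑ p ∈ m.divisors ×ˢ n.divisors, (zeta ^ k) p.1 * (zeta ^ k) p.2 :=
          sum_le_sum fun p _ ↦ ih p.1 p.2
      _ = (∑ a ∈ m.divisors, (zeta ^ k) a) * ∑ b ∈ n.divisors, (zeta ^ k) b := by
          rw [sum_mul_sum, sum_product]

lemma zeta_pow_mul_zeta_pow_le (s t n : ℕ) :
    (zeta ^ s) n * (zeta ^ t) n ≤ (zeta ^ (s * t)) n := by
  induction s generalizing n with
  | zero =>
    simp only [pow_zero, zero_mul, one_apply]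
    split_ifs with h
    · simp [h, (isMultiplicative_zeta.pow (k := t)).map_one]
    · simp
  | succ s ih =>
    rw [pow_succ, add_mul, one_mul, pow_add, mul_apply, mul_apply, sum_mul]
    refine sum_le_sum fun p hp ↦ ?_
    obtain ⟨rfl, hn⟩ := Nat.mem_divisorsAntidiagonal.1 hp
    have hz : zeta p.2 = 1 := by simp [right_ne_zero_of_mul hn]
    calc (zeta ^ s) p.1 * zeta p.2 * (zeta ^ t) (p.1 * p.2)
        ≤ (zeta ^ s) p.1 * 1 * ((zeta ^ t) p.1 * (zeta ^ t) p.2) := by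
          rw [hz]
          gcongr
          exact zeta_pow_apply_mul_le _ _ _
      _ = (zeta ^ s) p.1 * (zeta ^ t) p.1 * (zeta ^ t) p.2 := by ring
      _ ≤ _ := by gcongr; exact ih _

lemma zeta_pow_mul_zeta_pow_of_squarefree (s t : ℕ) {n : ℕ} (hn : Squarefree n) :
    (zeta ^ s) n * (zeta ^ t) n = (zeta ^ (s * t)) n := by
  induction s generalizing n with
  | zero =>
    simp only [pow_zero, zero_mul, one_apply]
    split_ifs with h
    · simp [h, (isMultiplicative_zeta.pow (k := t)).map_one]
    · simp
  | succ s ih =>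
    rw [pow_succ, add_mul, one_mul, pow_add, mul_apply, mul_apply, sum_mul]
    refine sum_congr rfl fun p hp ↦ ?_
    obtain ⟨rfl, -⟩ := Nat.mem_divisorsAntidiagonal.1 hp
    have hz : zeta p.2 = 1 := by simp [right_ne_zero_of_mul hn.ne_zero]
    rw [hz, (isMultiplicative_zeta.pow (k := t)).map_mul_of_coprime
      (Nat.coprime_of_squarefree_mul hn), ← ih (hn.of_mul_left)]
    ring

lemma sum_zeta_pow_succ (k N : ℕ) :
    ∑ n ∈ Ioc 0 N, (zeta ^ (k + 1)) n = ∑ n ∈ Ioc 0 N, ∑ m ∈ Ioc 0 (N / n), (zeta ^ k) m := by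
  rw [pow_succ', sum_Ioc_mul_eq_sum_sum]
  refine sum_congr rfl fun n hn ↦ ?_
  rw [zeta_apply_ne (by simp at hn; lia), one_mul]

lemma sum_Ioc_inv_eq_harmonic (N : ℕ) : ∑ n ∈ Ioc 0 N, (n : ℝ)⁻¹ = harmonic N := by
  rw [harmonic_eq_sum_Icc]
  push_cast
  rfl

lemma sum_zeta_pow_le (k N : ℕ) :
    (∑ n ∈ Ioc 0 N, ((zeta ^ (k + 1)) n : ℝ)) ≤ N * (1 + Real.log N) ^ k := by
  induction k generalizing N with
  | zero =>
    rw [zero_add, pow_one, pow_zero, mul_one]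
    exact_mod_cast (sum_Ioc_zeta N).le
  | succ k ih =>
    have h := sum_zeta_pow_succ (k + 1) N
    calc (∑ n ∈ Ioc 0 N, ((zeta ^ (k + 1 + 1)) n : ℝ))
        = ∑ n ∈ Ioc 0 N, ∑ m ∈ Ioc 0 (N / n), ((zeta ^ (k + 1)) m : ℝ) := by exact_mod_cast h
      _ ≤ ∑ n ∈ Ioc 0 N, N * (1 + Real.log N) ^ k * (n : ℝ)⁻¹ := by
          refine sum_le_sum fun n hn ↦ (ih _).trans ?_
          have hn := mem_Ioc.1 hn
          have hpos : 0 < N / n := Nat.div_pos hn.2 hn.1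
          have hlog := Real.log_natCast_nonneg (N / n)
          rw [mul_right_comm, ← div_eq_mul_inv]
          gcongr
          · exact Nat.cast_div_le
          · exact Nat.div_le_self _ _
      _ ≤ N * (1 + Real.log N) ^ k * (1 + Real.log N) := by
          have hlog := Real.log_natCast_nonneg N
          rw [← mul_sum, sum_Ioc_inv_eq_harmonic]
          gcongr
          exact harmonic_le_one_add_log N
      _ = _ := by ring

lemma exists_le_sum_zeta_pow (k : ℕ) : ∃ c : ℝ, 0 < c ∧ ∀ x : ℝ, 1 ≤ x →
    c * x * Real.log x ^ k ≤ ∑ n ∈ Ioc 0 ⌊x⌋₊, ((zeta ^ (k + 1)) n : ℝ) := by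
  induction k with
  | zero =>
    refine ⟨1 / 2, by norm_num, fun x hx ↦ ?_⟩
    have h : (∑ n ∈ Ioc 0 ⌊x⌋₊, (zeta n : ℝ)) = ⌊x⌋₊ := by exact_mod_cast sum_Ioc_zeta ⌊x⌋₊
    have h1 : (1 : ℝ) ≤ ⌊x⌋₊ := by exact_mod_cast Nat.floor_pos.2 hx
    rw [zero_add, pow_one, h, pow_zero]
    linarith [Nat.lt_floor_add_one x]
  | succ k ih =>
    obtain ⟨c, hc, ih⟩ := ih
    refine ⟨c / 2 ^ (k + 1), by positivity, fun x hx ↦ ?_⟩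
    have hx0 : 0 < x := by linarith
    have hlog := Real.log_nonneg hx
    have hsq : √x ≤ x := by
      rw [Real.sqrt_le_left hx0.le]
      nlinarith
    have h := sum_zeta_pow_succ (k + 1) ⌊x⌋₊
    calc c / 2 ^ (k + 1) * x * Real.log x ^ (k + 1)
        = c * x * (Real.log x / 2) ^ k * Real.log √x := by
          rw [Real.log_sqrt hx0.le, div_pow]
          field_simp
          ring
      _ ≤ c * x * (Real.log x / 2) ^ k * ∑ n ∈ Ioc 0 ⌊√x⌋₊, (n : ℝ)⁻¹ := by
          rw [sum_Ioc_inv_eq_harmonic]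
          gcongr
          exact log_le_harmonic_floor _ (Real.sqrt_nonneg x)
      _ ≤ ∑ n ∈ Ioc 0 ⌊√x⌋₊, ∑ m ∈ Ioc 0 (⌊x⌋₊ / n), ((zeta ^ (k + 1)) m : ℝ) := by
          rw [mul_sum]
          refine sum_le_sum fun n hn ↦ ?_
          have hn := mem_Ioc.1 hn
          have hn0 : (0 : ℝ) < n := by exact_mod_cast hn.1
          have hnx : (n : ℝ) ≤ √x := (Nat.le_floor_iff (Real.sqrt_nonneg x)).1 hn.2
          have hxn : √x ≤ x / n := by
            rw [le_div_iff₀ hn0]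
            calc √x * n ≤ √x * √x := by gcongr
              _ = x := Real.mul_self_sqrt hx0.le
          rw [← Nat.floor_div_natCast]
          refine le_trans ?_ (ih (x / n) ?_)
          · have hl : Real.log x / 2 ≤ Real.log (x / n) := by
              rw [← Real.log_sqrt hx0.le]
              exact Real.log_le_log (Real.sqrt_pos.2 hx0) hxn
            calc c * x * (Real.log x / 2) ^ k * (n : ℝ)⁻¹
                = c * (x / n) * (Real.log x / 2) ^ k := by ring
              _ ≤ _ := by gcongr
          · exact (Real.one_le_sqrt.2 hx).trans hxn
      _ ≤ ∑ n ∈ Ioc 0 ⌊x⌋₊, ∑ m ∈ Ioc 0 (⌊x⌋₊ / n), ((zeta ^ (k + 1)) m : ℝ) := by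
          refine sum_le_sum_of_subset_of_nonneg
            (Ioc_subset_Ioc_right (Nat.floor_le_floor hsq)) fun _ _ _ ↦ ?_
          positivity
      _ = _ := by exact_mod_cast h.symm

lemma summable_zeta_pow_div_sq (k : ℕ) :
    Summable fun n : ℕ ↦ ((zeta ^ k) n : ℝ) / (n : ℝ) ^ 2 := by
  have h : LSeriesSummable (fun n ↦ ((zeta ^ k : ArithmeticFunction ℕ) : ArithmeticFunction ℂ) n)
      2 := by
    induction k with
    | zero =>
      refine summable_of_ne_finset_zero (s := {1}) fun n hn ↦ ?_
      rw [mem_singleton] at hn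
      simp [LSeries.term_def, one_apply, hn]
    | succ k ih =>
      rw [pow_succ, natCoe_mul]
      exact LSeriesSummable_mul ih (LSeriesSummable_zeta_iff.2 (by norm_num))
  refine h.norm.congr fun n ↦ ?_
  rw [LSeries.norm_term_eq]
  split_ifs with hn
  · simp [hn]
  · simp

/-- The function supported on the squares that agrees with `zeta ^ k` there. -/
noncomputable def squarePart (k : ℕ) : ArithmeticFunction ℝ where
  toFun n := if IsSquare n then ((zeta ^ k) n : ℝ) else 0
  map_zero' := by simp

lemma squarePart_nonneg (k n : ℕ) : 0 ≤ squarePart k n := by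
  simp only [squarePart, coe_mk]
  split_ifs <;> positivity

lemma summable_squarePart_div (k : ℕ) : Summable fun n : ℕ ↦ squarePart k n / n := by
  have hinj : Function.Injective fun b : ℕ ↦ b * b := fun a b h ↦ Nat.mul_self_inj.1 h
  rw [← hinj.summable_iff]
  · refine (summable_zeta_pow_div_sq (k * k)).of_nonneg_of_le (fun b ↦ ?_) fun b ↦ ?_
    · exact div_nonneg (squarePart_nonneg _ _) (Nat.cast_nonneg _)
    · have h : (zeta ^ k) (b * b) ≤ (zeta ^ (k * k)) b :=
        (zeta_pow_apply_mul_le k b b).trans (zeta_pow_mul_zeta_pow_le k k b)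
      simp only [Function.comp_apply, squarePart, coe_mk, IsSquare.mul_self, if_true,
        Nat.cast_mul, pow_two]
      gcongr
  · rintro n hn
    have : ¬ IsSquare n := fun ⟨b, hb⟩ ↦ hn ⟨b, hb.symm⟩
    simp [squarePart, this]

/-- The square of the `t`-fold divisor function, as a real arithmetic function. -/
noncomputable def zetaPowSq (t : ℕ) : ArithmeticFunction ℝ where
  toFun n := ((zeta ^ t) n : ℝ) ^ 2
  map_zero' := by simp

lemma zetaPowSq_nonneg (t n : ℕ) : 0 ≤ zetaPowSq t n := sq_nonneg ((zeta ^ t) n : ℝ)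

lemma zeta_pow_le_squarePart_mul (t n : ℕ) :
    ((zeta ^ t ^ 2) n : ℝ) ≤ (squarePart (t ^ 2) * zetaPowSq t) n := by
  rcases Nat.eq_zero_or_pos n with rfl | hn
  · simp
  obtain ⟨s, b, hsb, hs⟩ := Nat.sq_mul_squarefree n
  rw [mul_apply]
  have hmem : (b ^ 2, s) ∈ n.divisorsAntidiagonal :=
    Nat.mem_divisorsAntidiagonal.2 ⟨hsb, hn.ne'⟩
  refine le_trans ?_ (single_le_sum (fun p _ ↦ mul_nonneg (squarePart_nonneg _ _)
    (zetaPowSq_nonneg _ _)) hmem)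
  have h := zeta_pow_apply_mul_le (t ^ 2) (b ^ 2) s
  rw [hsb] at h
  have hts := zeta_pow_mul_zeta_pow_of_squarefree t t hs
  rw [← pow_two, ← pow_two] at hts
  rw [← hts] at h
  simp only [squarePart, zetaPowSq, coe_mk, IsSquare.sq, if_true]
  exact_mod_cast h

lemma sum_zetaPowSq_le (t N : ℕ) :
    ∑ n ∈ Ioc 0 N, zetaPowSq t n ≤ ∑ n ∈ Ioc 0 N, ((zeta ^ t ^ 2) n : ℝ) := by
  refine sum_le_sum fun n _ ↦ ?_
  have h := zeta_pow_mul_zeta_pow_le t t n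
  rw [← pow_two, ← pow_two] at h
  simp only [zetaPowSq, coe_mk]
  exact_mod_cast h

lemma sum_zeta_pow_floor_le (k m : ℕ) {x : ℝ} (hx : 2 ≤ x) :
    ∑ n ∈ Ioc 0 (⌊x⌋₊ / m), ((zeta ^ (k + 1)) n : ℝ) ≤ x / m * (3 * Real.log x) ^ k := by
  have hlog : (1 : ℝ) / 2 ≤ Real.log x :=
    (by linarith [Real.log_two_gt_d9] : (1 : ℝ) / 2 ≤ Real.log 2).trans
      (Real.log_le_log two_pos hx)
  have hle : ((⌊x⌋₊ / m : ℕ) : ℝ) ≤ x / m :=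
    Nat.cast_div_le.trans (by gcongr; exact Nat.floor_le (by linarith))
  have hlogle : Real.log (⌊x⌋₊ / m : ℕ) ≤ Real.log x := by
    rcases Nat.eq_zero_or_pos (⌊x⌋₊ / m) with h | h
    · rw [h, Nat.cast_zero, Real.log_zero]
      linarith
    · refine Real.log_le_log (by exact_mod_cast h) ?_
      exact (Nat.cast_le.2 (Nat.div_le_self _ _)).trans (Nat.floor_le (by linarith))
  have hnn := Real.log_natCast_nonneg (⌊x⌋₊ / m)
  refine (sum_zeta_pow_le k _).trans ?_
  gcongr
  linarith

lemma exists_le_sum_zetaPowSq {t k : ℕ} (htk : t ^ 2 = k + 1) : ∃ c : ℝ, 0 < c ∧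
    ∀ x : ℝ, 2 ≤ x → c * x * Real.log x ^ k ≤ ∑ n ∈ Ioc 0 ⌊x⌋₊, zetaPowSq t n := by
  obtain ⟨c, hc, hlower⟩ := exists_le_sum_zeta_pow k
  obtain ⟨s, hs⟩ := summable_iff_vanishing_norm.1 (summable_squarePart_div (t ^ 2))
    (c / (2 * 3 ^ k)) (by positivity)
  set G := ∑ m ∈ s, squarePart (t ^ 2) m
  have hG : 0 ≤ G := sum_nonneg fun m _ ↦ squarePart_nonneg _ _
  refine ⟨c / (2 * (G + 1)), by positivity, fun x hx ↦ ?_⟩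
  have hlog : 0 ≤ Real.log x := Real.log_nonneg (by linarith)
  set N := ⌊x⌋₊
  set H := ∑ n ∈ Ioc 0 N, zetaPowSq t n
  have hH : 0 ≤ H := sum_nonneg fun n _ ↦ zetaPowSq_nonneg t n
  have hsmall : ∑ m ∈ Ioc 0 N with m ∈ s,
      squarePart (t ^ 2) m * ∑ n ∈ Ioc 0 (N / m), zetaPowSq t n ≤ G * H := by
    calc _ ≤ ∑ m ∈ Ioc 0 N with m ∈ s, squarePart (t ^ 2) m * H := by
          gcongr with m hm
          · exact squarePart_nonneg _ _
          · exact sum_le_sum_of_subset_of_nonneg (Ioc_subset_Ioc_right (Nat.div_le_self _ _))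
              fun n _ _ ↦ zetaPowSq_nonneg t n
      _ ≤ G * H := by
          rw [← sum_mul]
          gcongr
          exact sum_le_sum_of_subset_of_nonneg (fun m hm ↦ (mem_filter.1 hm).2)
            fun m _ _ ↦ squarePart_nonneg _ _
  have hlarge : ∑ m ∈ Ioc 0 N with m ∉ s,
      squarePart (t ^ 2) m * ∑ n ∈ Ioc 0 (N / m), zetaPowSq t n
        ≤ c / 2 * x * Real.log x ^ k := by
    calc _ ≤ ∑ m ∈ Ioc 0 N with m ∉ s,
            squarePart (t ^ 2) m / m * (x * (3 * Real.log x) ^ k) := by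
          refine sum_le_sum fun m _ ↦ ?_
          have h := (sum_zetaPowSq_le t (N / m)).trans
            (htk ▸ sum_zeta_pow_floor_le k m hx)
          calc _ ≤ squarePart (t ^ 2) m * (x / m * (3 * Real.log x) ^ k) :=
                mul_le_mul_of_nonneg_left h (squarePart_nonneg _ _)
            _ = _ := by ring
      _ ≤ c / (2 * 3 ^ k) * (x * (3 * Real.log x) ^ k) := by
          rw [← sum_mul]
          gcongr
          refine (le_abs_self _).trans (hs _ ?_).le
          exact disjoint_left.2 fun m hm ↦ (mem_filter.1 hm).2
      _ = _ := by
          rw [mul_pow]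
          field_simp
  have htotal : c * x * Real.log x ^ k ≤ G * H + c / 2 * x * Real.log x ^ k := by
    calc _ ≤ ∑ n ∈ Ioc 0 N, ((zeta ^ (t ^ 2)) n : ℝ) := htk ▸ hlower x (by linarith)
      _ ≤ ∑ n ∈ Ioc 0 N, (squarePart (t ^ 2) * zetaPowSq t) n :=
          sum_le_sum fun n _ ↦ zeta_pow_le_squarePart_mul t n
      _ ≤ _ := by
          rw [sum_Ioc_mul_eq_sum_sum, ← sum_filter_add_sum_filter_not _ (· ∈ s)]
          exact add_le_add hsmall hlarge
  rw [div_mul_eq_mul_div, div_mul_eq_mul_div, div_le_iff₀ (by positivity)]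
  linarith

end PiltzDivisor

/-- For `t ≥ 1` there are constants `c, C > 0` depending only on `t` such that for all
real `x ≥ 2`: `c·x·(log x)^{t²−1} ≤ Σ_{n ≤ x} d_t(n)² ≤ C·x·(log x)^{t²−1}`. -/
theorem statement_4 (t : ℕ) (ht : 1 ≤ t) :
    ∃ c C : ℝ, 0 < c ∧ 0 < C ∧ ∀ x : ℝ, 2 ≤ x →
      c * x * Real.log x ^ (t ^ 2 - 1) ≤ (∑ n ∈ Finset.Icc 1 ⌊x⌋₊, (dt t n : ℝ) ^ 2) ∧
        (∑ n ∈ Finset.Icc 1 ⌊x⌋₊, (dt t n : ℝ) ^ 2) ≤ C * x * Real.log x ^ (t ^ 2 - 1) := by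
  obtain ⟨k, hk⟩ : ∃ k, t ^ 2 = k + 1 := Nat.exists_eq_add_one.2 (by positivity)
  have hsum (N : ℕ) : ∑ n ∈ Finset.Icc 1 N, (dt t n : ℝ) ^ 2 =
      ∑ n ∈ Finset.Ioc 0 N, PiltzDivisor.zetaPowSq t n := by
    refine Finset.sum_congr rfl fun n hn ↦ ?_
    rw [PiltzDivisor.dt_eq_zeta_pow t (by simp at hn; lia)]
    rfl
  obtain ⟨c, hc, hlower⟩ := PiltzDivisor.exists_le_sum_zetaPowSq hk
  refine ⟨c, 3 ^ k, hc, by positivity, fun x hx ↦ ?_⟩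
  rw [hsum, hk, Nat.add_sub_cancel]
  refine ⟨hlower x hx, (PiltzDivisor.sum_zetaPowSq_le t _).trans ?_⟩
  have h := PiltzDivisor.sum_zeta_pow_floor_le k 1 hx
  rw [Nat.div_one, ← hk, Nat.cast_one, div_one, mul_pow] at h
  linarith
end

section
/- Let H, t ≥ 1 be integers and fix i ∈ {1, …, t}. There exists a constant C (depending only on H and t) such that the following holds. Let f₁, …, f_t: ℕ → ℝ be multiplicative functions with |f_j(p^k)| ≤ H^k for all prime powers p^k and all j. Let T ≥ 16 be real, let Q be a positive integer, let A* be a residue coprime to Q, let P ⊆ ℕ be any set, and let w ≥ 4Ht be real. Suppose there is c ≥ 1 such that for every positive integer D ≤ exp((log log T)²) and every residue A' coprime to Q one has S_{|f_i|}(T/D; Q, A') ≤ c·max_{A'' coprime to Q} S_{|f_i|}(T; Q, A''). Then Σ over positive integers D ≤ exp((log log T)²) all of whose prime factors exceed w, Σ over tuples (d₁, …, d_t) of positive integers with d₁⋯d_t ≤ T, d₁⋯d_t ≡ A* (mod Q), d₁⋯d_t ∈ P, and ∏_{j ≠ i} d_j = D, of |f₁(d₁)⋯f_t(d_t)|, is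 at most C·c·(log log T)^{2H(t−1)}·(T/Q)·max_{A' coprime to Q} S_{|f_i|}(T; Q, A'). -/
open scoped Classical

/-- `Savg g x q r = (q/x)·Σ_{n ≤ x, n ≡ r (mod q)} g(n)`. -/
noncomputable def Savg (g : ℕ → ℝ) (x : ℝ) (q r : ℕ) : ℝ :=
  ((q : ℝ) / x) * ∑ n ∈ Finset.Icc 1 ⌊x⌋₊, if n % q = r % q then g n else 0

/-- `maxS g x Q = max_{a coprime to Q} Savg g x Q a`. -/
noncomputable def maxS (g : ℕ → ℝ) (x : ℝ) (Q : ℕ) : ℝ :=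
  sSup {y : ℝ | ∃ a : ℕ, Nat.Coprime a Q ∧ y = Savg g x Q a}

theorem IsMult.abs_le_pow_cardFactors {f : ℕ → ℝ} (hf : IsMult f) {H : ℕ}
    (hb : ∀ p k : ℕ, p.Prime → 1 ≤ k → |f (p ^ k)| ≤ (H : ℝ) ^ k) {n : ℕ} (hn : n ≠ 0) :
    |f n| ≤ (H : ℝ) ^ ArithmeticFunction.cardFactors n := by
  induction n using Nat.recOnPosPrimePosCoprime with
  | prime_pow p k hp hk =>
    rw [ArithmeticFunction.cardFactors_apply_prime_pow hp]
    exact hb p k hp hk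
  | zero => exact absurd rfl hn
  | one => simp [hf.1]
  | coprime a b ha hb' hab iha ihb =>
    rw [hf.2 a b hab, abs_mul, ArithmeticFunction.cardFactors_mul (by lia) (by lia), pow_add]
    exact mul_le_mul (iha (by lia)) (ihb (by lia)) (abs_nonneg _) (by positivity)

theorem sum_squarefree_pow_cardFactors_div_le (H N : ℕ) :
    ∑ a ∈ (Finset.Icc 1 N).filter Squarefree,
        (H : ℝ) ^ ArithmeticFunction.cardFactors a / a ≤ (∑ n ∈ Finset.Icc 1 N, (1 : ℝ) / n) ^ H := by
  have hpow : (∑ n ∈ Finset.Icc 1 N, (1 : ℝ) / n) ^ H =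
      ∑ u ∈ Fintype.piFinset (fun _ : Fin H => Finset.Icc 1 N), ∏ j, (1 : ℝ) / (u j : ℕ) := by
    exact Finset.sum_pow' _ _ _
  have hterm : ∀ a ∈ (Finset.Icc 1 N).filter Squarefree,
      (H : ℝ) ^ ArithmeticFunction.cardFactors a / a =
        ∑ u ∈ Nat.finMulAntidiag H a, ∏ j, (1 : ℝ) / (u j : ℕ) := by
    intro a ha
    have hsq := (Finset.mem_filter.1 ha).2
    rw [Finset.sum_congr rfl (g := fun _ => (1 : ℝ) / a), Finset.sum_const,
      Nat.card_finMulAntidiag_of_squarefree hsq,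
      (ArithmeticFunction.cardDistinctFactors_eq_cardFactors_iff_squarefree hsq.ne_zero).2 hsq]
    · simp [div_eq_mul_inv]
    · intro u hu
      rw [Finset.prod_div_distrib, ← (Nat.mem_finMulAntidiag.1 hu).1]
      simp
  rw [hpow, Finset.sum_congr rfl hterm, Finset.sum_sigma']
  have hinj : Set.InjOn (fun x : (_ : ℕ) × (Fin H → ℕ) => x.2)
      (((Finset.Icc 1 N).filter Squarefree).sigma fun a => Nat.finMulAntidiag H a) := by
    rintro ⟨a, u⟩ hu ⟨b, v⟩ hv h
    simp only [Finset.coe_sigma, Set.mem_sigma_iff, Finset.mem_coe, Nat.mem_finMulAntidiag] at hu hv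
    simp only at h
    subst h
    rw [← hu.2.1, ← hv.2.1]
  rw [← Finset.sum_image (f := fun u : Fin H → ℕ => ∏ j, (1 : ℝ) / (u j : ℕ)) hinj]
  refine Finset.sum_le_sum_of_subset_of_nonneg ?_ fun u _ _ => by positivity
  intro u hu
  obtain ⟨⟨a, v⟩, hv, rfl⟩ := Finset.mem_image.1 hu
  simp only [Finset.mem_sigma, Finset.mem_filter, Finset.mem_Icc, Nat.mem_finMulAntidiag] at hv
  obtain ⟨⟨⟨ha1, haN⟩, -⟩, hprod, ha0⟩ := hv
  refine Fintype.mem_piFinset.2 fun j => Finset.mem_Icc.2 ?_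
  have hdvd : v j ∣ a := hprod ▸ Finset.dvd_prod_of_mem v (Finset.mem_univ j)
  exact ⟨Nat.pos_of_dvd_of_pos hdvd ha1, (Nat.le_of_dvd ha1 hdvd).trans haN⟩

/-- The completely multiplicative function `n ↦ (H ^ Ω n / n) ^ 2` restricted to the integers
all of whose prime factors exceed `w`. -/
noncomputable def roughSqHom (H : ℕ) (w : ℝ) : ℕ →* ℝ where
  toFun n := if n ≠ 0 ∧ ∀ p : ℕ, p.Prime → p ∣ n → w < (p : ℝ) then
    ((H : ℝ) ^ ArithmeticFunction.cardFactors n / n) ^ 2 else 0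
  map_one' := by
    have h : ∀ p : ℕ, p.Prime → p ∣ 1 → w < (p : ℝ) := fun p hp h1 => absurd h1 hp.not_dvd_one
    rw [if_pos ⟨one_ne_zero, h⟩]
    simp
  map_mul' m n := by
    by_cases hm : m ≠ 0 ∧ ∀ p : ℕ, p.Prime → p ∣ m → w < (p : ℝ)
    · by_cases hn : n ≠ 0 ∧ ∀ p : ℕ, p.Prime → p ∣ n → w < (p : ℝ)
      · rw [if_pos hm, if_pos hn, if_pos ⟨mul_ne_zero hm.1 hn.1, fun p hp h =>
          (hp.dvd_mul.1 h).elim (hm.2 p hp) (hn.2 p hp)⟩,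
          ArithmeticFunction.cardFactors_mul hm.1 hn.1, pow_add]
        push_cast
        rw [mul_div_mul_comm, mul_pow]
      · rw [if_neg hn, mul_zero, if_neg fun h => hn ⟨right_ne_zero_of_mul h.1, fun p hp hd =>
          h.2 p hp (hd.mul_left m)⟩]
    · rw [if_neg hm, zero_mul, if_neg fun h => hm ⟨left_ne_zero_of_mul h.1, fun p hp hd =>
          h.2 p hp (hd.mul_right n)⟩]

theorem inv_one_sub_le_exp {x : ℝ} (h0 : 0 ≤ x) (h1 : x ≤ 1 / 2) :
    (1 - x)⁻¹ ≤ Real.exp (2 * x) := by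
  refine le_trans ?_ (Real.add_one_le_exp (2 * x))
  rw [inv_le_iff_one_le_mul₀ (by linarith)]
  nlinarith

theorem sum_rough_sq_le {H : ℕ} (hH : 1 ≤ H) {w : ℝ} (hw : 4 * (H : ℝ) ≤ w) (N : ℕ) :
    ∑ b ∈ (Finset.Icc 1 N).filter (fun b => ∀ p : ℕ, p.Prime → p ∣ b → w < (p : ℝ)),
        ((H : ℝ) ^ ArithmeticFunction.cardFactors b / b) ^ 2 ≤ Real.exp (4 * (H : ℝ) ^ 2) := by
  have hH' : (1 : ℝ) ≤ H := by exact_mod_cast hH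
  have hprime : ∀ p : ℕ, p.Prime →
      0 ≤ roughSqHom H w p ∧ roughSqHom H w p ≤ 1 / 2 ∧
        roughSqHom H w p ≤ (H : ℝ) ^ 2 * ((p : ℝ) ^ 2)⁻¹ := by
    intro p hp
    have hp0 : (0 : ℝ) < p := by exact_mod_cast hp.pos
    change 0 ≤ ite _ _ _ ∧ ite _ _ _ ≤ _ ∧ ite _ _ _ ≤ _
    split_ifs with h
    · have hwp := h.2 p hp dvd_rfl
      rw [ArithmeticFunction.cardFactors_apply_prime hp, pow_one]
      refine ⟨by positivity, ?_, by rw [div_pow, div_eq_mul_inv]⟩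
      have : (H : ℝ) / p ≤ 1 / 4 := by
        rw [div_le_div_iff₀ hp0 (by norm_num)]
        linarith
      have h0 : (0 : ℝ) ≤ H / p := by positivity
      nlinarith
    · exact ⟨le_rfl, by norm_num, by positivity⟩
  obtain ⟨-, hsum⟩ := EulerProduct.summable_and_hasSum_smoothNumbers_prod_primesBelow_geometric
    (f := roughSqHom H w) (fun {p} hp => by
      rw [Real.norm_eq_abs, abs_of_nonneg (hprime p hp).1]
      linarith [(hprime p hp).2.1]) (N + 1)
  have hnonneg : ∀ n, 0 ≤ roughSqHom H w n := by
    intro n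
    change 0 ≤ ite _ _ _
    split_ifs <;> positivity
  set R := (Finset.Icc 1 N).filter (fun b => ∀ p : ℕ, p.Prime → p ∣ b → w < (p : ℝ))
  have hsmooth : ∀ b ∈ R, b ∈ (N + 1).smoothNumbers := by
    intro b hb
    have hb' := Finset.mem_Icc.1 (Finset.mem_filter.1 hb).1
    exact Nat.mem_smoothNumbers_of_lt hb'.1 (Nat.lt_succ_of_le hb'.2)
  have hle : ∑ b ∈ R, ((H : ℝ) ^ ArithmeticFunction.cardFactors b / b) ^ 2 ≤
      ∏ p ∈ (N + 1).primesBelow, (1 - roughSqHom H w p)⁻¹ := by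
    have h1 : ∑ b ∈ R, ((H : ℝ) ^ ArithmeticFunction.cardFactors b / b) ^ 2 =
        ∑ b ∈ R.subtype (· ∈ (N + 1).smoothNumbers), roughSqHom H w b := by
      rw [Finset.sum_subtype_of_mem (f := fun b => roughSqHom H w b) hsmooth]
      refine Finset.sum_congr rfl fun b hb => ?_
      have hb1 := Finset.mem_filter.1 hb
      have hb' := Finset.mem_Icc.1 hb1.1
      exact (if_pos ⟨by lia, hb1.2⟩).symm
    rw [h1]
    exact sum_le_hasSum _ (fun b _ => hnonneg b) hsum
  refine hle.trans ?_
  calc ∏ p ∈ (N + 1).primesBelow, (1 - roughSqHom H w p)⁻¹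
      ≤ ∏ p ∈ (N + 1).primesBelow, Real.exp (2 * ((H : ℝ) ^ 2 * ((p : ℝ) ^ 2)⁻¹)) := by
        refine Finset.prod_le_prod (fun p hp => ?_) fun p hp => ?_
        · have := (hprime p (Nat.prime_of_mem_primesBelow hp)).2.1
          exact inv_nonneg.2 (by linarith)
        · obtain ⟨h0, h1, h2⟩ := hprime p (Nat.prime_of_mem_primesBelow hp)
          exact (inv_one_sub_le_exp h0 h1).trans (Real.exp_le_exp.2 (by linarith))
    _ = Real.exp (2 * (H : ℝ) ^ 2 * ∑ p ∈ (N + 1).primesBelow, ((p : ℝ) ^ 2)⁻¹) := by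
        rw [← Real.exp_sum, Finset.mul_sum]
        simp only [mul_assoc]
    _ ≤ Real.exp (4 * (H : ℝ) ^ 2) := by
        have hsq : ∑ p ∈ (N + 1).primesBelow, ((p : ℝ) ^ 2)⁻¹ ≤ 2 := by
          refine le_trans (Finset.sum_le_sum_of_subset_of_nonneg (t := Finset.Ioo 0 (N + 1))
            ?_ fun _ _ _ => by positivity) ((sum_Ioo_inv_sq_le 0 (N + 1)).trans (by norm_num))
          intro p hp
          exact Finset.mem_Ioo.2 ⟨(Nat.prime_of_mem_primesBelow hp).pos,
            Nat.lt_of_mem_primesBelow hp⟩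
        refine Real.exp_le_exp.2 ?_
        nlinarith [sq_nonneg (H : ℝ)]

theorem sum_rough_pow_cardFactors_div_le {H : ℕ} (hH : 1 ≤ H) {w : ℝ} (hw : 4 * (H : ℝ) ≤ w)
    (N : ℕ) :
    ∑ n ∈ (Finset.Icc 1 N).filter (fun n => ∀ p : ℕ, p.Prime → p ∣ n → w < (p : ℝ)),
        (H : ℝ) ^ ArithmeticFunction.cardFactors n / n ≤
      Real.exp (4 * (H : ℝ) ^ 2) * (∑ n ∈ Finset.Icc 1 N, (1 : ℝ) / n) ^ H := by
  refine le_trans ?_ (mul_le_mul (sum_rough_sq_le hH hw N)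
    (sum_squarefree_pow_cardFactors_div_le H N) (by positivity) (by positivity))
  set R := (Finset.Icc 1 N).filter (fun b => ∀ p : ℕ, p.Prime → p ∣ b → w < (p : ℝ)) with hR
  choose a b hab hsq using Nat.sq_mul_squarefree
  rw [Finset.sum_mul_sum, ← Finset.sum_product']
  have hinj : Set.InjOn (fun n => (b n, a n)) (R : Set ℕ) := by
    intro m _ n _ h
    simp only [Prod.mk.injEq] at h
    rw [← hab m, ← hab n, h.1, h.2]
  have hterm : ∀ n ∈ R, (H : ℝ) ^ ArithmeticFunction.cardFactors n / n =
      ((H : ℝ) ^ ArithmeticFunction.cardFactors (b n) / (b n : ℕ)) ^ 2 *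
        ((H : ℝ) ^ ArithmeticFunction.cardFactors (a n) / (a n : ℕ)) := by
    intro n hn
    have hn0 : n ≠ 0 := by
      have := Finset.mem_Icc.1 (Finset.mem_filter.1 hn).1
      lia
    have h0 : b n ^ 2 * a n ≠ 0 := by rwa [hab]
    conv_lhs => rw [← hab n]
    rw [ArithmeticFunction.cardFactors_mul (left_ne_zero_of_mul h0) (right_ne_zero_of_mul h0),
      ArithmeticFunction.cardFactors_pow, pow_add, mul_comm 2, pow_mul]
    push_cast
    rw [mul_div_mul_comm, div_pow]
  rw [Finset.sum_congr rfl hterm, ← Finset.sum_image (f := fun x : ℕ × ℕ =>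
    ((H : ℝ) ^ ArithmeticFunction.cardFactors x.1 / (x.1 : ℕ)) ^ 2 *
        ((H : ℝ) ^ ArithmeticFunction.cardFactors x.2 / (x.2 : ℕ))) hinj]
  refine Finset.sum_le_sum_of_subset_of_nonneg ?_ fun _ _ _ => by positivity
  intro x hx
  obtain ⟨n, hn, rfl⟩ := Finset.mem_image.1 hx
  obtain ⟨hn1, hn2⟩ := Finset.mem_filter.1 hn
  rw [Finset.mem_Icc] at hn1
  have hb : b n ∣ n := (dvd_pow_self (b n) two_ne_zero).trans (Dvd.intro _ (hab n))
  have ha : a n ∣ n := Dvd.intro_left _ (hab n)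
  simp only [hR, Finset.mem_product, Finset.mem_filter, Finset.mem_Icc]
  exact ⟨⟨⟨Nat.pos_of_dvd_of_pos hb hn1.1, (Nat.le_of_dvd hn1.1 hb).trans hn1.2⟩,
    fun p hp hd => hn2 p hp (hd.trans hb)⟩,
    ⟨Nat.pos_of_dvd_of_pos ha hn1.1, (Nat.le_of_dvd hn1.1 ha).trans hn1.2⟩, hsq n⟩

theorem sum_fiber_le {g : ℕ → ℝ} (hg : ∀ n, 0 ≤ g n) {T M : ℝ} (hT : 0 < T) (hM : 0 ≤ M)
    {Q : ℕ} (hQ : 1 ≤ Q) {A : ℕ} (hA : Nat.Coprime A Q) {E : ℕ} (hE : 1 ≤ E)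
    (h : ∀ A' : ℕ, Nat.Coprime A' Q → Savg g (T / E) Q A' ≤ M) (N : ℕ) :
    ∑ m ∈ Finset.Icc 1 N, (if ((m * E : ℕ) : ℝ) ≤ T ∧ (m * E) % Q = A % Q then g m else 0) ≤
      T / Q * M * (1 / E) := by
  have hE0 : (0 : ℝ) < E := by exact_mod_cast hE
  have hQ0 : (0 : ℝ) < Q := by exact_mod_cast hQ
  by_cases hEQ : Nat.Coprime E Q
  · obtain ⟨B, -, hB⟩ := Nat.exists_mul_mod_eq_of_coprime A hEQ (by lia)
    have hBQ : Nat.Coprime B Q := by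
      have h1 : Nat.Coprime (E * B) Q := by
        exact (Nat.ModEq.gcd_eq hB).trans hA
      exact Nat.Coprime.coprime_mul_left h1
    have hS := h B hBQ
    unfold Savg at hS
    have hle : ∑ m ∈ Finset.Icc 1 N,
        (if ((m * E : ℕ) : ℝ) ≤ T ∧ (m * E) % Q = A % Q then g m else 0) ≤
        ∑ m ∈ Finset.Icc 1 ⌊T / E⌋₊, if m % Q = B % Q then g m else 0 := by
      rw [← Finset.sum_filter, ← Finset.sum_filter]
      refine Finset.sum_le_sum_of_subset_of_nonneg ?_ fun _ _ _ => hg _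
      intro m hm
      simp only [Finset.mem_filter, Finset.mem_Icc] at hm ⊢
      refine ⟨⟨hm.1.1, Nat.le_floor ?_⟩, ?_⟩
      · rw [le_div_iff₀ hE0]
        exact_mod_cast hm.2.1
      · have h2 : m * E ≡ B * E [MOD Q] := by
          rw [Nat.ModEq, hm.2.2, mul_comm B E, hB]
        exact Nat.ModEq.cancel_right_of_coprime hEQ.symm h2
    refine hle.trans ?_
    have hpos : 0 < (Q : ℝ) / (T / E) := by positivity
    rw [← le_div_iff₀' hpos] at hS
    refine hS.trans (le_of_eq ?_)
    field_simp
  · rw [Finset.sum_eq_zero]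
    · positivity
    · intro m _
      refine if_neg fun hc => hEQ ?_
      have h1 : Nat.Coprime (m * E) Q := by
        exact (Nat.ModEq.gcd_eq hc.2).trans hA
      exact Nat.Coprime.coprime_mul_left h1

theorem sum_piFinset_insertNth {n : ℕ} (i : Fin (n + 1)) (S : Finset ℕ)
    (F : (Fin (n + 1) → ℕ) → ℝ) :
    ∑ d ∈ Fintype.piFinset (fun _ : Fin (n + 1) => S), F d =
      ∑ e ∈ Fintype.piFinset (fun _ : Fin n => S), ∑ m ∈ S, F (i.insertNth m e) := by
  rw [Finset.sum_comm, ← Finset.sum_product']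
  refine Finset.sum_nbij' (fun d => (d i, i.removeNth d)) (fun x => i.insertNth x.1 x.2)
    ?_ ?_ ?_ ?_ ?_
  · intro d hd
    rw [Fintype.mem_piFinset] at hd
    simp [Fin.removeNth, hd]
  · rintro ⟨m, e⟩ h
    simpa [Fin.forall_iff_succAbove i] using h
  · intro d _
    simp
  · rintro ⟨m, e⟩ _
    simp
  · intro d _
    simp

theorem one_le_log_log {T : ℝ} (hT : 16 ≤ T) : 1 ≤ Real.log (Real.log T) := by
  have h16 : Real.log 16 = 4 * Real.log 2 := by
    rw [show (16 : ℝ) = 2 ^ 4 by norm_num, Real.log_pow]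
    norm_num
  have h : Real.exp 1 ≤ Real.log T := by
    have h1 : Real.log 16 ≤ Real.log T := Real.log_le_log (by norm_num) hT
    linarith [Real.exp_one_lt_d9, Real.log_two_gt_d9]
  exact (Real.le_log_iff_exp_le ((Real.exp_pos 1).trans_le h)).2 h

theorem sum_one_div_le {L : ℝ} (hL : 1 ≤ L) :
    ∑ n ∈ Finset.Icc 1 ⌊Real.exp (L ^ 2)⌋₊, (1 : ℝ) / n ≤ 2 * L ^ 2 := by
  have h := harmonic_floor_le_one_add_log (Real.exp (L ^ 2)) (Real.one_le_exp (by positivity))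
  rw [Real.log_exp, harmonic_eq_sum_Icc] at h
  push_cast at h
  simp only [one_div]
  nlinarith

theorem prod_erase_insertNth {n : ℕ} (i : Fin (n + 1)) (m : ℕ) (e : Fin n → ℕ) :
    ∏ j ∈ Finset.univ.erase i, (i.insertNth m e : Fin (n + 1) → ℕ) j = ∏ j, e j := by
  rw [show (Finset.univ.erase i : Finset (Fin (n + 1))) =
    Finset.univ.map i.succAboveEmb by ext j; simp [Fin.exists_succAbove_eq_iff]]
  simp

/-- The sum over tuples whose coordinates other than the `i`-th have rough product at most
`exp (L ^ 2)`, with explicit constant. -/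
theorem small_divisor_sum_le {H n : ℕ} (hH : 1 ≤ H) (i : Fin (n + 1))
    {f : Fin (n + 1) → ℕ → ℝ} (hf : ∀ j, IsMult (f j))
    (hb : ∀ j, ∀ p k : ℕ, p.Prime → 1 ≤ k → |f j (p ^ k)| ≤ (H : ℝ) ^ k)
    {T : ℝ} (hT : 0 < T) {Q : ℕ} (hQ : 1 ≤ Q) {A : ℕ} (hA : Nat.Coprime A Q) (P : Set ℕ)
    {w : ℝ} (hw : 4 * (H : ℝ) ≤ w) {M L : ℝ} (hM : 0 ≤ M) (hL : 1 ≤ L)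
    (h : ∀ D : ℕ, 1 ≤ D → (D : ℝ) ≤ Real.exp (L ^ 2) →
      ∀ A' : ℕ, Nat.Coprime A' Q → Savg (fun m => |f i m|) (T / D) Q A' ≤ M) :
    (∑ D ∈ Finset.Icc 1 ⌊Real.exp (L ^ 2)⌋₊,
      if ∀ p : ℕ, p.Prime → p ∣ D → w < (p : ℝ) then
        ∑' d : Fin (n + 1) → ℕ,
          if ((∀ j, 1 ≤ d j) ∧ ((∏ j, d j : ℕ) : ℝ) ≤ T ∧
              (∏ j, d j) % Q = A % Q ∧ (∏ j, d j) ∈ P ∧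
              ∏ j ∈ Finset.univ.erase i, d j = D) then
            ∏ j, |f j (d j)|
          else 0
      else 0) ≤
    T / Q * M * (Real.exp (4 * (H : ℝ) ^ 2) * (2 * L ^ 2) ^ H) ^ n := by
  set N := ⌊Real.exp (L ^ 2)⌋₊
  set S := Finset.Icc 1 ⌊T⌋₊
  set rough : ℕ → Prop := fun D => ∀ p : ℕ, p.Prime → p ∣ D → w < (p : ℝ)
  set R := (Finset.Icc 1 N).filter rough
  set F : ℕ → (Fin (n + 1) → ℕ) → ℝ := fun D d =>
    if rough D ∧ (∀ j, 1 ≤ d j) ∧ ((∏ j, d j : ℕ) : ℝ) ≤ T ∧ (∏ j, d j) % Q = A % Q ∧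
      (∏ j, d j) ∈ P ∧ ∏ j ∈ Finset.univ.erase i, d j = D then ∏ j, |f j (d j)| else 0 with hF
  have htsum : ∀ D ∈ Finset.Icc 1 N, (if rough D then
        ∑' d : Fin (n + 1) → ℕ,
          if ((∀ j, 1 ≤ d j) ∧ ((∏ j, d j : ℕ) : ℝ) ≤ T ∧
              (∏ j, d j) % Q = A % Q ∧ (∏ j, d j) ∈ P ∧
              ∏ j ∈ Finset.univ.erase i, d j = D) then
            ∏ j, |f j (d j)|
          else 0
      else 0) = ∑ d ∈ Fintype.piFinset (fun _ : Fin (n + 1) => S), F D d := by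
    intro D _
    by_cases hD : rough D
    · rw [if_pos hD, tsum_eq_sum (s := Fintype.piFinset (fun _ : Fin (n + 1) => S))]
      · simp only [hF, hD, true_and]
      · intro d hd
        refine if_neg fun hc => hd (Fintype.mem_piFinset.2 fun j => Finset.mem_Icc.2 ⟨hc.1 j, ?_⟩)
        refine Nat.le_floor (le_trans ?_ hc.2.1)
        exact_mod_cast Finset.single_le_prod' (f := d) (fun j _ => hc.1 j) (Finset.mem_univ j)
    · rw [if_neg hD]
      simp [hF, hD]
  rw [Finset.sum_congr rfl htsum, Finset.sum_comm, sum_piFinset_insertNth i]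
  have hterm : ∀ (e : Fin n → ℕ) (m : ℕ), ∑ D ∈ Finset.Icc 1 N, F D (i.insertNth m e) ≤
      if (∀ j, e j ∈ R) ∧ ∏ j, e j ≤ N then
        (∏ j, |f (i.succAbove j) (e j)|) *
          (if ((m * ∏ j, e j : ℕ) : ℝ) ≤ T ∧ (m * ∏ j, e j) % Q = A % Q then |f i m| else 0)
      else 0 := by
    intro e m
    have hRHS : 0 ≤ if (∀ j, e j ∈ R) ∧ ∏ j, e j ≤ N then
        (∏ j, |f (i.succAbove j) (e j)|) *
          (if ((m * ∏ j, e j : ℕ) : ℝ) ≤ T ∧ (m * ∏ j, e j) % Q = A % Q then |f i m| else 0)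
        else 0 := by
      have h1 : 0 ≤ ∏ j, |f (i.succAbove j) (e j)| := Finset.prod_nonneg fun _ _ => abs_nonneg _
      split_ifs
      · exact mul_nonneg h1 (abs_nonneg _)
      · simp
      · exact le_rfl
    have hprod : ∏ j, (i.insertNth m e : Fin (n + 1) → ℕ) j = m * ∏ j, e j := by
      simp [Fin.prod_univ_succAbove _ i]
    by_cases hex : ∃ D ∈ Finset.Icc 1 N, F D (i.insertNth m e) ≠ 0
    · obtain ⟨D, hD, hne⟩ := hex
      have hc : rough D ∧ (∀ j, 1 ≤ (i.insertNth m e : Fin (n + 1) → ℕ) j) ∧ _ :=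
        (ite_ne_right_iff.1 hne).1
      rw [Finset.sum_eq_single_of_mem D hD fun D' _ hD' =>
        if_neg fun hc' => hD' (hc'.2.2.2.2.2.symm.trans hc.2.2.2.2.2)]
      obtain ⟨hrD, -, hle, hmod, -, hDe⟩ := hc
      have hFD : F D (i.insertNth m e) = _ := if_pos (ite_ne_right_iff.1 hne).1
      rw [prod_erase_insertNth] at hDe
      rw [hprod] at hle hmod
      rw [Finset.mem_Icc] at hD
      have hdvd : ∀ j, e j ∣ D := fun j => hDe ▸ Finset.dvd_prod_of_mem e (Finset.mem_univ j)
      have heR : ∀ j, e j ∈ R := fun j => Finset.mem_filter.2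
        ⟨Finset.mem_Icc.2 ⟨Nat.pos_of_dvd_of_pos (hdvd j) hD.1,
          (Nat.le_of_dvd hD.1 (hdvd j)).trans hD.2⟩,
          fun p hp hpd => hrD p hp (hpd.trans (hdvd j))⟩
      refine hFD.trans_le ?_
      rw [if_pos ⟨heR, hDe ▸ hD.2⟩, if_pos ⟨hle, hmod⟩, Fin.prod_univ_succAbove _ i]
      simp [mul_comm]
    · push Not at hex
      rw [Finset.sum_eq_zero hex]
      exact hRHS
  have hinner : ∀ e : Fin n → ℕ,
      ∑ m ∈ S, ∑ D ∈ Finset.Icc 1 N, F D (i.insertNth m e) ≤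
        if ∀ j, e j ∈ R then
          T / Q * M * ∏ j, (|f (i.succAbove j) (e j)| / (e j : ℕ)) else 0 := by
    intro e
    refine (Finset.sum_le_sum fun m _ => hterm e m).trans ?_
    have h1 : 0 ≤ ∏ j, |f (i.succAbove j) (e j)| := Finset.prod_nonneg fun _ _ => abs_nonneg _
    by_cases he : ∀ j, e j ∈ R
    · rw [if_pos he]
      by_cases heN : ∏ j, e j ≤ N
      · simp only [if_pos (And.intro he heN)]
        have hE : 1 ≤ ∏ j, e j := Finset.one_le_prod' fun j _ =>
          (Finset.mem_Icc.1 (Finset.mem_filter.1 (he j)).1).1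
        have hEX : ((∏ j, e j : ℕ) : ℝ) ≤ Real.exp (L ^ 2) :=
          (Nat.le_floor_iff (Real.exp_pos _).le).1 heN
        rw [← Finset.mul_sum]
        refine (mul_le_mul_of_nonneg_left (sum_fiber_le (fun m => abs_nonneg (f i m)) hT hM hQ hA
          hE (h _ hE hEX) ⌊T⌋₊) h1).trans (le_of_eq ?_)
        rw [Finset.prod_div_distrib]
        push_cast
        ring
      · simp only [heN, and_false, if_false, Finset.sum_const_zero]
        have : 0 ≤ ∏ j, (|f (i.succAbove j) (e j)| / (e j : ℕ)) :=
          Finset.prod_nonneg fun _ _ => by positivity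
        positivity
    · simp [he]
  calc ∑ e ∈ Fintype.piFinset (fun _ : Fin n => S), ∑ m ∈ S,
        ∑ D ∈ Finset.Icc 1 N, F D (i.insertNth m e)
      ≤ ∑ e ∈ Fintype.piFinset (fun _ : Fin n => S), if ∀ j, e j ∈ R then
          T / Q * M * ∏ j, (|f (i.succAbove j) (e j)| / (e j : ℕ)) else 0 :=
        Finset.sum_le_sum fun e _ => hinner e
    _ ≤ ∑ e ∈ Fintype.piFinset (fun _ : Fin n => R),
          T / Q * M * ∏ j, (|f (i.succAbove j) (e j)| / (e j : ℕ)) := by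
        rw [← Finset.sum_filter]
        refine Finset.sum_le_sum_of_subset_of_nonneg
          (fun e he => Fintype.mem_piFinset.2 (Finset.mem_filter.1 he).2) fun e _ _ => ?_
        have : 0 ≤ ∏ j, (|f (i.succAbove j) (e j)| / (e j : ℕ)) :=
          Finset.prod_nonneg fun _ _ => by positivity
        positivity
    _ = T / Q * M * ∏ j, ∑ d ∈ R, |f (i.succAbove j) d| / (d : ℕ) := by
        rw [← Finset.mul_sum,
          Finset.sum_prod_piFinset R fun j d => |f (i.succAbove j) d| / (d : ℕ)]
    _ ≤ T / Q * M * ∏ _j : Fin n, (Real.exp (4 * (H : ℝ) ^ 2) * (2 * L ^ 2) ^ H) := by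
        refine mul_le_mul_of_nonneg_left (Finset.prod_le_prod
          (fun j _ => Finset.sum_nonneg fun _ _ => by positivity) fun j _ => ?_) (by positivity)
        calc ∑ d ∈ R, |f (i.succAbove j) d| / (d : ℕ)
            ≤ ∑ d ∈ R, (H : ℝ) ^ ArithmeticFunction.cardFactors d / d := by
              refine Finset.sum_le_sum fun d hd => ?_
              have hd1 := (Finset.mem_Icc.1 (Finset.mem_filter.1 hd).1).1
              gcongr
              exact (hf _).abs_le_pow_cardFactors (hb _) (by lia)
          _ ≤ Real.exp (4 * (H : ℝ) ^ 2) * (∑ n ∈ Finset.Icc 1 N, (1 : ℝ) / n) ^ H :=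
              sum_rough_pow_cardFactors_div_le hH hw N
          _ ≤ Real.exp (4 * (H : ℝ) ^ 2) * (2 * L ^ 2) ^ H := by
              gcongr
              exact sum_one_div_le hL
    _ = T / Q * M * (Real.exp (4 * (H : ℝ) ^ 2) * (2 * L ^ 2) ^ H) ^ n := by
        simp

/-- Contribution of small `D`: for `H, t ≥ 1` and `i ∈ {1,…,t}` there is `C` (depending
only on `H, t`) such that, under a mean-value stability hypothesis for `|f_i|`, the sum
over `D ≤ exp((log log T)²)` with all prime factors exceeding `w`, and over tuples
`(d₁,…,d_t)` with `d₁⋯d_t ≤ T`, `d₁⋯d_t ≡ A* (mod Q)`, `d₁⋯d_t ∈ P`, `∏_{j≠i} d_j = D`,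
of `|f₁(d₁)⋯f_t(d_t)|` is at most
`C·c·(log log T)^{2H(t−1)}·(T/Q)·max_{A'} S_{|f_i|}(T;Q,A')`. -/
theorem statement_7 (H t : ℕ) (hH : 1 ≤ H) (ht : 1 ≤ t) (i : Fin t) :
    ∃ C : ℝ, 0 < C ∧
      ∀ fi : Fin t → ℕ → ℝ, (∀ j, IsMult (fi j)) →
      (∀ j, ∀ p k : ℕ, p.Prime → 1 ≤ k → |fi j (p ^ k)| ≤ (H : ℝ) ^ k) →
      ∀ T : ℝ, 16 ≤ T →
      ∀ Q : ℕ, 1 ≤ Q →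
      ∀ Astar : ℕ, Nat.Coprime Astar Q →
      ∀ P : Set ℕ,
      ∀ w : ℝ, 4 * (H : ℝ) * (t : ℝ) ≤ w →
      ∀ c : ℝ, 1 ≤ c →
      (∀ D : ℕ, 1 ≤ D → (D : ℝ) ≤ Real.exp (Real.log (Real.log T) ^ 2) →
        ∀ A' : ℕ, Nat.Coprime A' Q →
          Savg (fun n => |fi i n|) (T / D) Q A' ≤ c * maxS (fun n => |fi i n|) T Q) →
      (∑ D ∈ Finset.Icc 1 ⌊Real.exp (Real.log (Real.log T) ^ 2)⌋₊,
        if ∀ p : ℕ, p.Prime → p ∣ D → w < (p : ℝ) then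
          ∑' d : Fin t → ℕ,
            if ((∀ j, 1 ≤ d j) ∧ ((∏ j, d j : ℕ) : ℝ) ≤ T ∧
                (∏ j, d j) % Q = Astar % Q ∧ (∏ j, d j) ∈ P ∧
                ∏ j ∈ Finset.univ.erase i, d j = D) then
              ∏ j, |fi j (d j)|
            else 0
        else 0) ≤
      C * c * Real.log (Real.log T) ^ (2 * H * (t - 1)) * (T / Q) *
        maxS (fun n => |fi i n|) T Q := by
  obtain ⟨n, rfl⟩ : ∃ n, t = n + 1 := ⟨t - 1, by lia⟩
  refine ⟨(Real.exp (4 * (H : ℝ) ^ 2) * 2 ^ H) ^ n, by positivity, ?_⟩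
  intro f hf hb T hT Q hQ A hA P w hw c hc h
  have hL := one_le_log_log hT
  have hT0 : 0 < T := by linarith
  have hw' : 4 * (H : ℝ) ≤ w := by
    refine le_trans ?_ hw
    push_cast
    nlinarith [(Nat.cast_nonneg H : (0 : ℝ) ≤ H), (Nat.cast_nonneg n : (0 : ℝ) ≤ n)]
  have hM : 0 ≤ c * maxS (fun m => |f i m|) T Q := by
    refine le_trans ?_ (h 1 le_rfl ?_ A hA)
    · unfold Savg
      refine mul_nonneg (by positivity) (Finset.sum_nonneg fun m _ => ?_)
      split_ifs <;> positivity
    · rw [Nat.cast_one]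
      exact Real.one_le_exp (by positivity)
  refine (small_divisor_sum_le hH i hf hb hT0 hQ hA P hw' hM hL h).trans (le_of_eq ?_)
  rw [Nat.add_sub_cancel]
  ring
end
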